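/- arXiv:1107.1434 — 2 statements merged into one kernel-verified Lean document; each statement's English description precedes it below -/
import Mathlib

section
/- There exists a universal constant C > 0 with the following property. For all integers k ≥ 2, m, t ≥ 1, all nonzero t-sparse polynomials f_1, …, f_m ∈ ℝ[X], and all natural numbers α_{ij} (1 ≤ i ≤ k, 1 ≤ j ≤ m), if the polynomial φ = ∑_{i=1}^k ∏_{j=1}^m f_j^{α_{ij}} is not identically zero, then the number of distinct real roots of φ is at most C · (e · (1 + t^m / (2^{k−1} − 1)))^(2^{k−1} − 1), where e is Euler's number. -/
open Polynomial

/-- Rolle's theorem for the quotient `p / g`, in terms of the Wronskian of `g` and `p`. -/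
theorem card_roots_sdiff_le_card_roots_wronskian {p g : ℝ[X]} {E : Finset ℝ}
    (hE : ∀ x, g.eval x = 0 → x ∈ E) (hW : wronskian g p ≠ 0) :
    (p.roots.toFinset \ E).card ≤ ((wronskian g p).roots.toFinset ∪ E).card + 1 := by
  have hp : p ≠ 0 := by rintro rfl; simp at hW
  refine Finset.card_le_of_interleaved fun x hx y hy hxy _ => ?_
  simp only [Finset.mem_sdiff, Multiset.mem_toFinset, mem_roots hp, IsRoot.def] at hx hy
  by_cases h : ∃ z ∈ Set.Icc x y, g.eval z = 0
  · obtain ⟨z, ⟨hxz, hzy⟩, hz⟩ := h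
    have hzE := hE z hz
    refine ⟨z, Finset.mem_union_right _ hzE, lt_of_le_of_ne hxz ?_, lt_of_le_of_ne hzy ?_⟩
    · rintro rfl; exact hx.2 hzE
    · rintro rfl; exact hy.2 hzE
  · push Not at h
    obtain ⟨z, hz, hz0⟩ := exists_hasDerivAt_eq_zero (f := fun u => p.eval u / g.eval u)
      (f' := fun u => (p.derivative.eval u * g.eval u - p.eval u * g.derivative.eval u) /
        g.eval u ^ 2) hxy (p.continuousOn.div g.continuousOn h) (by simp [hx.1, hy.1])
      (fun u hu => (p.hasDerivAt u).div (g.hasDerivAt u) (h u (Set.Ioo_subset_Icc_self hu)))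
    have hgz := h z (Set.Ioo_subset_Icc_self hz)
    refine ⟨z, Finset.mem_union_left _ ?_, hz.1, hz.2⟩
    rw [Multiset.mem_toFinset, mem_roots hW, IsRoot.def]
    rw [div_eq_zero_iff, or_iff_left (pow_ne_zero 2 hgz)] at hz0
    simp only [wronskian, eval_sub, eval_mul]
    linarith

theorem eval_eq_zero_of_wronskian_eq_zero {p g : ℝ[X]} (hp : p ≠ 0) (hW : wronskian g p = 0)
    {x : ℝ} (hx : p.eval x = 0) : g.eval x = 0 := by
  obtain ⟨q, hq, hndvd⟩ := exists_eq_pow_rootMultiplicity_mul_and_not_dvd p hp x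
  have hpos : 0 < p.rootMultiplicity x := (rootMultiplicity_pos hp).2 hx
  obtain ⟨r, hr⟩ := Nat.exists_eq_succ_of_ne_zero hpos.ne'
  rw [hr] at hq
  rw [dvd_iff_isRoot, IsRoot.def] at hndvd
  have h : (X - C x) ^ r * (g * (C ((r : ℝ) + 1) * q + (X - C x) * derivative q)
      - derivative g * (X - C x) * q) = 0 := by
    rw [← hW, hq, wronskian]
    simp only [derivative_mul, derivative_X_sub_C_pow, Nat.succ_eq_add_one]
    simp
    ring
  have h2 := (mul_eq_zero.1 h).resolve_left (pow_ne_zero _ (X_sub_C_ne_zero x))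
  have h3 := congrArg (eval x) h2
  simp at h3
  rcases h3 with h3 | h3 | h3
  · exact h3
  · exact absurd h3 (by positivity)
  · exact absurd h3 hndvd

/-- A weak form of Descartes' rule of signs. -/
theorem card_roots_erase_zero_le {p : ℝ[X]} (hp : p ≠ 0) :
    (p.roots.toFinset.erase 0).card ≤ 2 * (p.support.card - 1) := by
  induction h : p.support.card using Nat.strong_induction_on generalizing p with
  | _ n ih =>
  subst h
  set d := p.natDegree with hd
  set q : ℝ[X] := X * derivative p - C (d : ℝ) * p with hq
  have hcoeff : ∀ i, q.coeff i = ((i : ℝ) - d) * p.coeff i := by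
    intro i
    rw [hq, coeff_sub, coeff_C_mul]
    cases i with
    | zero => simp
    | succ i => rw [coeff_X_mul, coeff_derivative]; push_cast; ring
  have hsupp : q.support = p.support.erase d := by
    ext i
    simp [hcoeff, sub_eq_zero]
  have hcard : q.support.card + 1 = p.support.card := by
    rw [hsupp, Finset.card_erase_add_one (natDegree_mem_support_of_nonzero hp)]
  have hW : X * wronskian (X ^ d) p = X ^ d * q := by
    rw [wronskian, hq, derivative_X_pow]
    rcases d with _ | d
    · simp
    · simp; ring
  have hE : ∀ x : ℝ, (X ^ d : ℝ[X]).eval x = 0 → x ∈ ({0} : Finset ℝ) := by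
    intro x hx
    simp at hx
    simp [hx.1]
  by_cases hq0 : q = 0
  · have hW0 : wronskian (X ^ d) p = 0 := by
      rw [hq0, mul_zero] at hW
      exact (mul_eq_zero.1 hW).resolve_left X_ne_zero
    have : p.roots.toFinset.erase 0 = ∅ := by
      ext x
      simp only [Finset.mem_erase, Multiset.mem_toFinset, mem_roots hp, IsRoot.def,
        Finset.notMem_empty, iff_false, not_and]
      intro hx0 hx
      exact hx0 (by simpa using hE x (eval_eq_zero_of_wronskian_eq_zero hp hW0 hx))
    simp [this]
  · have hW0 : wronskian (X ^ d) p ≠ 0 := by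
      intro h0
      rw [h0, mul_zero] at hW
      exact (mul_ne_zero (pow_ne_zero _ X_ne_zero) hq0) hW.symm
    have h1 := card_roots_sdiff_le_card_roots_wronskian hE hW0
    have h2 : (wronskian (X ^ d) p).roots.toFinset ∪ {0} ⊆ insert 0 (q.roots.toFinset.erase 0) := by
      intro x hx
      simp only [Finset.mem_union, Multiset.mem_toFinset, mem_roots hW0, IsRoot.def,
        Finset.mem_singleton, Finset.mem_insert, Finset.mem_erase, mem_roots hq0] at hx ⊢
      by_cases hx0 : x = 0
      · exact Or.inl hx0
      · refine Or.inr ⟨hx0, ?_⟩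
        have := congrArg (eval x) hW
        simp only [eval_mul, eval_X, hx.resolve_right hx0, mul_zero, eval_pow] at this
        exact (mul_eq_zero.1 this.symm).resolve_left (pow_ne_zero _ hx0)
    have h3 := (Finset.card_le_card h2).trans (Finset.card_insert_le _ _)
    have h4 := ih _ (by omega) hq0 rfl
    have h5 : 0 < q.support.card := Finset.card_pos.2 (nonempty_support_iff.2 hq0)
    rw [← Finset.erase_eq] at h1
    omega

theorem card_roots_le {p : ℝ[X]} (hp : p ≠ 0) :
    p.roots.toFinset.card ≤ 2 * p.support.card := by
  have h1 := card_roots_erase_zero_le hp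
  have h2 : 0 < p.support.card := Finset.card_pos.2 (nonempty_support_iff.2 hp)
  have h3 := Finset.pred_card_le_card_erase (s := p.roots.toFinset) (a := 0)
  omega

open scoped Pointwise in
theorem card_nsmul_le_choose (S : Finset ℕ) (n : ℕ) :
    (n • S).card ≤ (S.card + n - 1).choose n := by
  have h : n • S ⊆ (Finset.univ : Finset (Sym S n)).image
      fun m : Sym S n => ((m : Multiset S).map Subtype.val).sum := by
    induction n with
    | zero =>
      intro x hx
      exact Finset.mem_image.2 ⟨Sym.nil, Finset.mem_univ _, by simpa [eq_comm] using hx⟩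
    | succ n ih =>
      intro x hx
      rw [succ_nsmul, Finset.mem_add] at hx
      obtain ⟨y, hy, z, hz, rfl⟩ := hx
      obtain ⟨m, -, rfl⟩ := Finset.mem_image.1 (ih hy)
      refine Finset.mem_image.2 ⟨(⟨z, hz⟩ : S) ::ₛ m, Finset.mem_univ _, ?_⟩
      rw [Sym.coe_cons, Multiset.map_cons, Multiset.sum_cons, add_comm]
  calc (n • S).card ≤ Fintype.card (Sym S n) := (Finset.card_le_card h).trans Finset.card_image_le
    _ = _ := by rw [Sym.card_sym_eq_choose, Fintype.card_coe]

open scoped Pointwise in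
theorem support_mul_subset_add {p q : ℝ[X]} {A B : Finset ℕ} (hp : p.support ⊆ A)
    (hq : q.support ⊆ B) : (p * q).support ⊆ A + B := by
  intro n hn
  rw [mem_support_iff, coeff_mul] at hn
  obtain ⟨⟨i, j⟩, hij, h⟩ := Finset.exists_ne_zero_of_sum_ne_zero hn
  rw [Finset.HasAntidiagonal.mem_antidiagonal] at hij
  rw [← hij]
  exact Finset.add_mem_add (hp (mem_support_iff.2 (left_ne_zero_of_mul h)))
    (hq (mem_support_iff.2 (right_ne_zero_of_mul h)))

open scoped Pointwise in
theorem support_one_subset_zero_nsmul (S : Finset ℕ) : (1 : ℝ[X]).support ⊆ 0 • S := by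
  rw [zero_nsmul]
  exact support_C_subset (1 : ℝ)

theorem support_X_mul_derivative_subset (p : ℝ[X]) : (X * derivative p).support ⊆ p.support := by
  intro n hn
  rw [mem_support_iff] at hn ⊢
  cases n with
  | zero => simp at hn
  | succ n =>
    rw [coeff_X_mul, coeff_derivative] at hn
    exact left_ne_zero_of_mul hn

open scoped Pointwise in
theorem support_prod_subset_sum {κ : Type*} (s : Finset κ) (f : κ → ℝ[X]) :
    (∏ j ∈ s, f j).support ⊆ ∑ j ∈ s, (f j).support := by
  classical
  induction s using Finset.induction_on with
  | empty => exact support_C_subset (1 : ℝ)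
  | insert j s hj ih =>
    rw [Finset.prod_insert hj, Finset.sum_insert hj]
    exact support_mul_subset_add subset_rfl ih

/-- The numerator of the logarithmic derivative of `∏ j, f j ^ e j` over the common
denominator `∏ j, f j`. -/
noncomputable def logDerivNumerator {κ : Type*} [Fintype κ] (f : κ → ℝ[X]) (e : κ → ℕ) : ℝ[X] :=
  open Classical in ∑ j, C (e j : ℝ) * ((∏ l ∈ Finset.univ.erase j, f l) * derivative (f j))

theorem prod_mul_derivative_prod_pow {κ : Type*} [Fintype κ] (f : κ → ℝ[X]) (e : κ → ℕ) :
    (∏ j, f j) * derivative (∏ j, f j ^ e j) = (∏ j, f j ^ e j) * logDerivNumerator f e := by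
  classical
  rw [derivative_prod_finset, logDerivNumerator, Finset.mul_sum, Finset.mul_sum]
  refine Finset.sum_congr rfl fun j _ => ?_
  rw [← Finset.mul_prod_erase _ f (Finset.mem_univ j),
    ← Finset.mul_prod_erase _ (fun l => f l ^ e l) (Finset.mem_univ j), derivative_pow]
  rcases e j with _ | n
  · simp
  · simp only [Nat.add_sub_cancel, pow_succ]
    ring_nf

open scoped Pointwise in
theorem support_X_mul_logDerivNumerator_subset {κ : Type*} [Fintype κ] (f : κ → ℝ[X])
    (e : κ → ℕ) : (X * logDerivNumerator f e).support ⊆ ∑ j, (f j).support := by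
  classical
  intro n hn
  rw [logDerivNumerator, Finset.mul_sum, mem_support_iff, finsetSum_coeff] at hn
  obtain ⟨j, -, hj⟩ := Finset.exists_ne_zero_of_sum_ne_zero hn
  rw [mul_left_comm, coeff_C_mul, mul_left_comm] at hj
  rw [← Finset.sum_erase_add _ _ (Finset.mem_univ j)]
  refine support_mul_subset_add (support_prod_subset_sum _ _)
    (support_X_mul_derivative_subset (f j)) (mem_support_iff.2 ?_)
  convert right_ne_zero_of_mul hj

/-- The coefficient of `∏ j, f j ^ d j` left when `p * ∏ j, f j ^ e j` is eliminated from a sum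
containing `q * ∏ j, f j ^ d j`, by dividing and differentiating. -/
noncomputable def eliminationCoeff {κ : Type*} [Fintype κ] (f : κ → ℝ[X]) (p q : ℝ[X])
    (e d : κ → ℕ) : ℝ[X] :=
  p * (X * derivative q) * (∏ j, f j) + p * q * (X * logDerivNumerator f d)
    - (X * derivative p) * q * (∏ j, f j) - p * q * (X * logDerivNumerator f e)

open scoped Pointwise in
theorem support_eliminationCoeff_subset {κ : Type*} [Fintype κ] (f : κ → ℝ[X]) {p q : ℝ[X]}
    (e d : κ → ℕ) {n : ℕ} (hp : p.support ⊆ n • ∑ j, (f j).support)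
    (hq : q.support ⊆ n • ∑ j, (f j).support) :
    (eliminationCoeff f p q e d).support ⊆ (2 * n + 1) • ∑ j, (f j).support := by
  have hp' := (support_X_mul_derivative_subset p).trans hp
  have hq' := (support_X_mul_derivative_subset q).trans hq
  have hF := support_prod_subset_sum Finset.univ f
  have key : ∀ {a b c : ℝ[X]}, a.support ⊆ n • ∑ j, (f j).support →
      b.support ⊆ n • ∑ j, (f j).support → c.support ⊆ ∑ j, (f j).support →
      (a * b * c).support ⊆ (2 * n + 1) • ∑ j, (f j).support := by
    intro a b c ha hb hc
    rw [succ_nsmul, two_mul, add_nsmul]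
    exact support_mul_subset_add (support_mul_subset_add ha hb) hc
  have h1 := key hp hq' hF
  have h2 := key hp hq (support_X_mul_logDerivNumerator_subset f d)
  have h3 := key hp' hq hF
  have h4 := key hp hq (support_X_mul_logDerivNumerator_subset f e)
  intro i hi
  by_contra hi'
  have z : ∀ {a : ℝ[X]}, a.support ⊆ (2 * n + 1) • ∑ j, (f j).support → a.coeff i = 0 :=
    fun h => notMem_support_iff.1 fun h' => hi' (h h')
  rw [mem_support_iff] at hi
  apply hi
  rw [eliminationCoeff, coeff_sub, coeff_sub, coeff_add, z h1, z h2, z h3, z h4]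
  simp

theorem X_mul_prod_mul_wronskian {κ : Type*} [Fintype κ] (f : κ → ℝ[X]) (p q : ℝ[X])
    (e d : κ → ℕ) :
    X * (∏ j, f j) * wronskian (p * ∏ j, f j ^ e j) (q * ∏ j, f j ^ d j) =
      (∏ j, f j ^ e j) * (eliminationCoeff f p q e d * ∏ j, f j ^ d j) := by
  have h1 := prod_mul_derivative_prod_pow f e
  have h2 := prod_mul_derivative_prod_pow f d
  simp only [wronskian, derivative_mul, eliminationCoeff]
  linear_combination (X * p * q * ∏ j, f j ^ e j) * h2 - (X * p * q * ∏ j, f j ^ d j) * h1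

theorem X_mul_prod_mul_wronskian_sum {ι κ : Type*} [DecidableEq ι] [Fintype κ] (f : κ → ℝ[X])
    (a : ι → ℝ[X]) (α : ι → κ → ℕ) {s : Finset ι} {i₀ : ι} (hi₀ : i₀ ∈ s) :
    X * (∏ j, f j) * wronskian (a i₀ * ∏ j, f j ^ α i₀ j) (∑ i ∈ s, a i * ∏ j, f j ^ α i j) =
      (∏ j, f j ^ α i₀ j) * ∑ i ∈ s.erase i₀,
        eliminationCoeff f (a i₀) (a i) (α i₀) (α i) * ∏ j, f j ^ α i j := by
  have h : ∀ (g : ℝ[X]) (q : ι → ℝ[X]),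
      wronskian g (∑ i ∈ s, q i) = ∑ i ∈ s, wronskian g (q i) := fun g q => by
    simp only [wronskian, derivative_sum, Finset.mul_sum, Finset.sum_sub_distrib]
  rw [h, ← Finset.add_sum_erase _ _ hi₀, wronskian_self_eq_zero, zero_add, Finset.mul_sum,
    Finset.mul_sum]
  exact Finset.sum_congr rfl fun i _ => X_mul_prod_mul_wronskian f _ _ _ _

open scoped Pointwise in
/-- Induction on the number of summands: divide by one of them and differentiate. -/
theorem card_roots_sum_mul_prod_pow_le {ι κ : Type*} [Fintype κ] {f : κ → ℝ[X]}
    (hf : ∀ j, f j ≠ 0) {N : ℕ → ℕ}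
    (hN : ∀ (n : ℕ) (p : ℝ[X]), p ≠ 0 →
      p.support ⊆ n • ∑ j, (f j).support → p.roots.toFinset.card ≤ N n)
    (α : ι → κ → ℕ) (k : ℕ) : ∀ (l : ℕ) (s : Finset ι) (a : ι → ℝ[X]), s.card ≤ k →
      (∀ i ∈ s, (a i).support ⊆ (2 ^ l - 1) • ∑ j, (f j).support) →
      (∑ i ∈ s, a i * ∏ j, f j ^ α i j) ≠ 0 →
      (∑ i ∈ s, a i * ∏ j, f j ^ α i j).roots.toFinset.card ≤
        ∑ r ∈ Finset.range k,
          (2 * N (2 ^ (l + r) - 1) + (2 * (X * ∏ j, f j).roots.toFinset.card + 1)) := by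
  classical
  induction k with
  | zero =>
    intro l s a hs _ hne
    rw [Finset.card_eq_zero.1 (Nat.le_zero.1 hs)] at hne
    simp at hne
  | succ k ih =>
    intro l s a hs ha hne
    obtain ⟨i₀, hi₀, h₀⟩ := Finset.exists_ne_zero_of_sum_ne_zero hne
    have ha₀ := left_ne_zero_of_mul h₀
    set φ := ∑ i ∈ s, a i * ∏ j, f j ^ α i j with hφ
    set ψ := ∑ i ∈ s.erase i₀,
      eliminationCoeff f (a i₀) (a i) (α i₀) (α i) * ∏ j, f j ^ α i j with hψ
    have hF : X * ∏ j, f j ≠ 0 := mul_ne_zero X_ne_zero (Finset.prod_ne_zero_iff.2 fun j _ => hf j)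
    have hW : X * (∏ j, f j) * wronskian (a i₀ * ∏ j, f j ^ α i₀ j) φ =
        (∏ j, f j ^ α i₀ j) * ψ := X_mul_prod_mul_wronskian_sum f a α hi₀
    have hT : ∀ x, (∏ j, f j ^ α i₀ j).eval x = 0 → (X * ∏ j, f j).eval x = 0 := by
      intro x hx
      rw [eval_prod, Finset.prod_eq_zero_iff] at hx
      obtain ⟨j, hj, hx⟩ := hx
      rw [eval_pow] at hx
      rw [eval_mul, eval_prod, Finset.prod_eq_zero hj (eq_zero_of_pow_eq_zero hx), mul_zero]
    set E := (a i₀).roots.toFinset ∪ (X * ∏ j, f j).roots.toFinset with hEdef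
    have hmem : ∀ x, x ∈ E ↔ (a i₀).eval x = 0 ∨ (X * ∏ j, f j).eval x = 0 := by
      intro x
      simp only [hEdef, Finset.mem_union, Multiset.mem_toFinset, mem_roots ha₀, mem_roots hF,
        IsRoot.def]
    have hE : ∀ x, (a i₀ * ∏ j, f j ^ α i₀ j).eval x = 0 → x ∈ E := by
      intro x hx
      rw [eval_mul, mul_eq_zero] at hx
      exact (hmem x).2 (hx.imp_right (hT x))
    have hEcard : E.card ≤ N (2 ^ l - 1) + (X * ∏ j, f j).roots.toFinset.card :=
      (Finset.card_union_le _ _).trans (Nat.add_le_add_right (hN _ _ ha₀ (ha i₀ hi₀)) _)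
    have hshift : ∀ r, 2 ^ (l + (r + 1)) - 1 = 2 ^ (l + 1 + r) - 1 := fun r => by
      rw [add_right_comm, add_assoc]
    rw [Finset.sum_range_succ']
    simp only [hshift, add_zero]
    by_cases hψ0 : ψ = 0
    · have hW0 : wronskian (a i₀ * ∏ j, f j ^ α i₀ j) φ = 0 := by
        rw [hψ0, mul_zero] at hW
        exact (mul_eq_zero.1 hW).resolve_left hF
      have hsub : φ.roots.toFinset ⊆ E := by
        intro x hx
        rw [Multiset.mem_toFinset, mem_roots hne, IsRoot.def] at hx
        exact hE x (eval_eq_zero_of_wronskian_eq_zero hne hW0 hx)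
      have := Finset.card_le_card hsub
      omega
    · have hT0 : (∏ j, f j ^ α i₀ j) ≠ 0 := right_ne_zero_of_mul h₀
      have hW0 : wronskian (a i₀ * ∏ j, f j ^ α i₀ j) φ ≠ 0 := by
        intro h
        rw [h, mul_zero] at hW
        exact mul_ne_zero hT0 hψ0 hW.symm
      have h1 := card_roots_sdiff_le_card_roots_wronskian hE hW0
      have h2 : (wronskian (a i₀ * ∏ j, f j ^ α i₀ j) φ).roots.toFinset ∪ E ⊆
          ψ.roots.toFinset ∪ E := by
        refine Finset.union_subset (fun x hx => ?_) Finset.subset_union_right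
        rw [Multiset.mem_toFinset, mem_roots hW0, IsRoot.def] at hx
        have := congrArg (eval x) hW
        rw [eval_mul, hx, mul_zero, eval_mul, zero_eq_mul] at this
        rw [Finset.mem_union, hmem, Multiset.mem_toFinset, mem_roots hψ0]
        exact this.elim (fun h => Or.inr (Or.inr (hT x h))) Or.inl
      have h3 := (Finset.card_le_card h2).trans (Finset.card_union_le _ _)
      have h4 := Finset.card_le_card_sdiff_add_card (s := φ.roots.toFinset) (t := E)
      have h5 := ih (l + 1) (s.erase i₀)
        (fun i => eliminationCoeff f (a i₀) (a i) (α i₀) (α i))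
        (by rw [Finset.card_erase_of_mem hi₀]; omega)
        (fun i hi => by
          have := support_eliminationCoeff_subset f (α i₀) (α i) (ha i₀ hi₀)
            (ha i (Finset.mem_of_mem_erase hi))
          have e : 2 ^ (l + 1) - 1 = 2 * (2 ^ l - 1) + 1 := by
            have := Nat.one_le_two_pow (n := l)
            rw [pow_succ]; omega
          rwa [e])
        hψ0
      rw [← hψ] at h5
      omega

/-- An upper bound for the binomial coefficient `(T + n - 1).choose n`. -/
noncomputable def powerBound (T n : ℕ) : ℝ := (Real.exp 1 * (1 + (T : ℝ) / n)) ^ n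

theorem choose_le_powerBound (T n : ℕ) : ((T + n - 1).choose n : ℝ) ≤ powerBound T n := by
  rcases Nat.eq_zero_or_pos n with rfl | hn
  · simp [powerBound]
  have hn' : (0 : ℝ) < n := by exact_mod_cast hn
  have h1 : ((T + n - 1).choose n : ℝ) ≤ ((T + n : ℕ) : ℝ) ^ n / n.factorial :=
    (Nat.choose_le_pow_div n _).trans (by gcongr; omega)
  have h2 : (n : ℝ) ^ n / n.factorial ≤ Real.exp 1 ^ n := by
    rw [← Real.exp_nat_mul, mul_one]
    exact Real.pow_div_factorial_le_exp n hn'.le n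
  calc ((T + n - 1).choose n : ℝ) ≤ ((T + n : ℕ) : ℝ) ^ n / n.factorial := h1
    _ = (n : ℝ) ^ n / n.factorial * (1 + (T : ℝ) / n) ^ n := by
      rw [div_mul_eq_mul_div, ← mul_pow]
      congr 2
      push_cast
      field_simp
      ring
    _ ≤ Real.exp 1 ^ n * (1 + (T : ℝ) / n) ^ n := by gcongr
    _ = powerBound T n := by rw [powerBound, mul_pow]

theorem one_add_div_pow_le_one_add_div_pow {x : ℝ} (hx : 0 ≤ x) {n n' : ℕ} (h : n ≤ n') :
    (1 + x / n) ^ n ≤ (1 + x / n') ^ n' := by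
  rcases Nat.eq_zero_or_pos n with rfl | hn
  · simpa using one_le_pow₀ (by simp; positivity)
  have hn0 : (0 : ℝ) < n := by exact_mod_cast hn
  have hn0' : (0 : ℝ) < n' := by exact_mod_cast hn.trans_le h
  have hb := one_add_mul_self_le_rpow_one_add (s := x / n') (p := n' / n)
    (by linarith [div_nonneg hx hn0'.le]) ((one_le_div hn0).2 (by exact_mod_cast h))
  have he : (n' : ℝ) / n * (x / n') = x / n := by field_simp
  rw [he] at hb
  calc (1 + x / n) ^ n ≤ ((1 + x / n') ^ ((n' : ℝ) / n)) ^ n := by gcongr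
    _ = (1 + x / n') ^ n' := by
      rw [← Real.rpow_natCast, ← Real.rpow_mul (by positivity), div_mul_cancel₀ _ hn0.ne',
        Real.rpow_natCast]

theorem two_pow_mul_powerBound_le (T : ℕ) {n n' : ℕ} (h : n ≤ n') :
    2 ^ (n' - n) * powerBound T n ≤ powerBound T n' := by
  have he : (2 : ℝ) ≤ Real.exp 1 := by linarith [Real.add_one_le_exp (1 : ℝ)]
  calc 2 ^ (n' - n) * powerBound T n
      ≤ Real.exp 1 ^ (n' - n) * (Real.exp 1 ^ n * (1 + (T : ℝ) / n') ^ n') := by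
        rw [powerBound, mul_pow]
        gcongr
        exact one_add_div_pow_le_one_add_div_pow T.cast_nonneg h
    _ = powerBound T n' := by
        rw [← mul_assoc, ← pow_add, Nat.sub_add_cancel h, powerBound, mul_pow]

theorem sum_powerBound_le (T k : ℕ) :
    ∑ r ∈ Finset.range (k + 1), powerBound T (2 ^ r - 1) ≤ 2 * powerBound T (2 ^ k - 1) := by
  induction k with
  | zero => simp [powerBound]
  | succ k ih =>
    rw [Finset.sum_range_succ]
    have h1 := Nat.one_le_two_pow (n := k)
    have h2 := two_pow_mul_powerBound_le T (n := 2 ^ k - 1) (n' := 2 ^ (k + 1) - 1)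
      (by rw [pow_succ]; omega)
    have h3 : (0 : ℝ) ≤ powerBound T (2 ^ k - 1) := by unfold powerBound; positivity
    have h4 : (2 : ℝ) ^ 1 ≤ 2 ^ (2 ^ (k + 1) - 1 - (2 ^ k - 1)) :=
      pow_le_pow_right₀ (by norm_num) (by rw [pow_succ]; omega)
    nlinarith [mul_le_mul_of_nonneg_right h4 h3]

theorem mul_one_add_le_powerBound (T k : ℕ) :
    ((k : ℝ) + 2) * (1 + T) ≤ powerBound T (2 ^ (k + 1) - 1) := by
  have h0 : k + 1 ≤ 2 ^ k := Nat.lt_two_pow_self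
  have h1 : 1 ≤ 2 ^ (k + 1) - 1 := by rw [pow_succ]; omega
  have h2 := two_pow_mul_powerBound_le T h1
  have h3 : (2 : ℝ) * (1 + T) ≤ powerBound T 1 := by
    have he : (2 : ℝ) ≤ Real.exp 1 := by linarith [Real.add_one_le_exp (1 : ℝ)]
    simp only [powerBound, pow_one, Nat.cast_one, div_one]
    gcongr
  have h4 : ((k : ℝ) + 1) ≤ 2 ^ (2 ^ (k + 1) - 1 - 1) := by
    have : k + 1 ≤ 2 ^ (2 ^ (k + 1) - 1 - 1) :=
      h0.trans (Nat.pow_le_pow_right two_pos (by rw [pow_succ]; omega))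
    exact_mod_cast this
  have hT : (0 : ℝ) ≤ T := T.cast_nonneg
  have hk : (0 : ℝ) ≤ k := k.cast_nonneg
  calc ((k : ℝ) + 2) * (1 + T) ≤ (k + 1) * (2 * (1 + T)) := by nlinarith [mul_nonneg hk hT]
    _ ≤ 2 ^ (2 ^ (k + 1) - 1 - 1) * powerBound T 1 := by gcongr
    _ ≤ _ := h2

open scoped Pointwise in
theorem card_sum_support_le {m t : ℕ} {f : Fin m → ℝ[X]} (ht : ∀ j, (f j).support.card ≤ t) :
    (∑ j, (f j).support).card ≤ t ^ m := by
  have h : ∀ s : Finset (Fin m), (∑ j ∈ s, (f j).support).card ≤ t ^ s.card := by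
    intro s
    induction s using Finset.induction_on with
    | empty => simp
    | insert j s hj ih =>
      rw [Finset.sum_insert hj, Finset.card_insert_of_notMem hj, pow_succ']
      exact Finset.card_add_le.trans (Nat.mul_le_mul (ht j) ih)
  simpa using h Finset.univ

theorem mul_pred_le_pow (m t : ℕ) : m * (t - 1) ≤ t ^ m := by
  rcases t with _ | t
  · simp
  have := one_add_mul_le_pow_of_sq_nonneg (R := ℕ) (a := t) (by positivity) (by positivity)
    (by positivity) m
  rw [Nat.add_sub_cancel]
  simp at this
  rw [add_comm t 1]
  omega

theorem card_roots_X_mul_prod_le {m t : ℕ} {f : Fin m → ℝ[X]}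
    (hf : ∀ j, f j ≠ 0 ∧ (f j).support.card ≤ t) :
    (X * ∏ j, f j).roots.toFinset.card ≤ 2 * t ^ m + 1 := by
  have hF : X * ∏ j, f j ≠ 0 :=
    mul_ne_zero X_ne_zero (Finset.prod_ne_zero_iff.2 fun j _ => (hf j).1)
  have hsub : (X * ∏ j, f j).roots.toFinset ⊆
      insert 0 (Finset.univ.biUnion fun j => (f j).roots.toFinset.erase 0) := by
    intro x hx
    rw [Multiset.mem_toFinset, mem_roots hF, IsRoot.def, eval_mul, eval_X, mul_eq_zero, eval_prod,
      Finset.prod_eq_zero_iff] at hx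
    rw [Finset.mem_insert, or_iff_not_imp_left]
    intro hx0
    obtain ⟨j, hj, h⟩ := hx.resolve_left hx0
    refine Finset.mem_biUnion.2 ⟨j, hj, Finset.mem_erase.2 ⟨hx0, ?_⟩⟩
    rwa [Multiset.mem_toFinset, mem_roots (hf j).1]
  have h1 := (Finset.card_le_card hsub).trans (Finset.card_insert_le _ _)
  have h2 : (Finset.univ.biUnion fun j => (f j).roots.toFinset.erase 0).card ≤
      (Finset.univ : Finset (Fin m)).card * (2 * (t - 1)) :=
    Finset.card_biUnion_le_card_mul _ _ _ fun j _ =>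
      (card_roots_erase_zero_le (hf j).1).trans (by have := (hf j).2; omega)
  have h3 := mul_pred_le_pow m t
  rw [Finset.card_univ, Fintype.card_fin, mul_left_comm] at h2
  omega

/-- There is a universal constant `C > 0` such that any nonzero sum of `k ≥ 2` products of
powers of `m` fixed `t`-sparse nonzero real polynomials has at most
`C * (e * (1 + t^m / (2^(k-1) - 1)))^(2^(k-1) - 1)` distinct real roots. -/
theorem real_tau_conjecture_restricted_tight :
    ∃ C : ℝ, 0 < C ∧
      ∀ (k m t : ℕ), 2 ≤ k → 1 ≤ m → 1 ≤ t →
        ∀ f : Fin m → ℝ[X],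
          (∀ j, f j ≠ 0 ∧ (f j).support.card ≤ t) →
          ∀ α : Fin k → Fin m → ℕ,
            (∑ i, ∏ j, f j ^ α i j) ≠ 0 →
              (({x : ℝ | (∑ i, ∏ j, f j ^ α i j).eval x = 0}.ncard : ℝ)) ≤
                C * (Real.exp 1 *
                    (1 + (t : ℝ) ^ m / ((2 ^ (k - 1) - 1 : ℕ) : ℝ))) ^ (2 ^ (k - 1) - 1) := by
  refine ⟨12, by norm_num, fun k m t hk _ _ f hf α hne => ?_⟩
  obtain ⟨k, rfl⟩ : ∃ l, k = l + 2 := ⟨k - 2, by omega⟩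
  have hset : {x : ℝ | (∑ i, ∏ j, f j ^ α i j).eval x = 0} =
      ((∑ i, ∏ j, f j ^ α i j).roots.toFinset : Set ℝ) := by
    ext x
    simp only [Set.mem_ofPred_eq, Finset.mem_coe, Multiset.mem_toFinset, mem_roots hne, IsRoot.def]
  rw [hset, Set.ncard_coe_finset]
  have h1 := card_roots_sum_mul_prod_pow_le (fun j => (hf j).1)
    (N := fun n => 2 * (t ^ m + n - 1).choose n)
    (fun n p hp hsupp => (card_roots_le hp).trans <| Nat.mul_le_mul_left 2 <|
      ((Finset.card_le_card hsupp).trans (card_nsmul_le_choose _ n)).trans <|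
        Nat.choose_le_choose _ <| by
          have := card_sum_support_le fun j => (hf j).2
          omega)
    α (k + 2) 0 Finset.univ (fun _ => 1) (by simp)
    (fun _ _ => by
      rw [pow_zero, Nat.sub_self]
      exact support_one_subset_zero_nsmul _)
    (by simpa only [one_mul] using hne)
  simp only [one_mul, zero_add] at h1
  have h2 := card_roots_X_mul_prod_le hf
  have h3 : ((∑ i, ∏ j, f j ^ α i j).roots.toFinset.card : ℝ) ≤
      ∑ r ∈ Finset.range (k + 2),
        (4 * powerBound (t ^ m) (2 ^ r - 1) + (4 * (t : ℝ) ^ m + 3)) := by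
    refine (Nat.cast_le.2 h1).trans ?_
    rw [Nat.cast_sum]
    refine Finset.sum_le_sum fun r _ => ?_
    have h4 := choose_le_powerBound (t ^ m) (2 ^ r - 1)
    have h5 : ((X * ∏ j, f j).roots.toFinset.card : ℝ) ≤ 2 * (t : ℝ) ^ m + 1 := by
      exact_mod_cast h2
    rw [Nat.cast_add, Nat.cast_add, Nat.cast_mul, Nat.cast_mul, Nat.cast_mul]
    push_cast at h4 ⊢
    linarith
  have h4 := sum_powerBound_le (t ^ m) (k + 1)
  have h5 := mul_one_add_le_powerBound (t ^ m) k
  rw [Finset.sum_add_distrib, ← Finset.mul_sum, Finset.sum_const, Finset.card_range,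
    nsmul_eq_mul] at h3
  have h6 : (12 : ℝ) * (Real.exp 1 * (1 + (t : ℝ) ^ m / ((2 ^ (k + 2 - 1) - 1 : ℕ) : ℝ))) ^
      (2 ^ (k + 2 - 1) - 1) = 12 * powerBound (t ^ m) (2 ^ (k + 1) - 1) := by
    rw [powerBound, Nat.cast_pow t m]
    rfl
  rw [h6]
  push_cast at h3 h5
  have hk0 : (0 : ℝ) ≤ k := k.cast_nonneg
  linarith
end

section
/- Let m, t, h ≥ 1 be integers, let g ∈ ℝ[X] be an h-sparse polynomial, let f_1, …, f_m ∈ ℝ[X] be nonzero t-sparse polynomials, and let α_1, …, α_m be natural numbers. If the polynomial P = g · ∏_{j=1}^m f_j^{α_j} is not identically zero, then the number of distinct real roots of P is at most 2h + 2m(t−1) − 1. -/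
open Polynomial

theorem Polynomial.signVariations_add_one_le_card_support {p : ℝ[X]} (hp : p ≠ 0) :
    p.signVariations + 1 ≤ p.support.card := by
  induction hn : p.support.card generalizing p with
  | zero => simp_all
  | succ n ih =>
    by_cases he : p.eraseLead = 0
    · have h : p = monomial p.natDegree p.leadingCoeff := by
        simpa [he] using (eraseLead_add_monomial_natDegree_leadingCoeff p).symm
      rw [h, signVariations_monomial]
      omega
    · have h := ih he (card_support_eraseLead' hn)
      have := signVariations_le_eraseLead_succ p
      omega

theorem Polynomial.card_filter_pos_roots_lt_card_support {p : ℝ[X]} (hp : p ≠ 0) :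
    {x ∈ p.roots.toFinset | 0 < x}.card + 1 ≤ p.support.card := by
  have h₁ := signVariations_add_one_le_card_support hp
  have h₂ := roots_countP_pos_le_signVariations p
  have h₃ : {x ∈ p.roots.toFinset | 0 < x}.card ≤ p.roots.countP (0 < ·) := by
    rw [← Multiset.toFinset_filter, Multiset.countP_eq_card_filter]
    exact Multiset.toFinset_card_le _
  omega

theorem Polynomial.card_support_comp_neg_X (p : ℝ[X]) :
    (p.comp (-X)).support.card = p.support.card := by
  congr 1
  ext n
  have h : (-X : ℝ[X]) = C (-1) * X := by simp
  rw [h, mem_support_iff, comp_C_mul_X_coeff]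
  simp

theorem Polynomial.card_filter_ne_zero_roots_le {p : ℝ[X]} (hp : p ≠ 0) :
    {x ∈ p.roots.toFinset | x ≠ 0}.card ≤ 2 * (p.support.card - 1) := by
  have hq : p.comp (-X) ≠ 0 := comp_neg_X_eq_zero_iff.not.2 hp
  have h₁ := card_filter_pos_roots_lt_card_support hp
  have h₂ := card_filter_pos_roots_lt_card_support hq
  rw [card_support_comp_neg_X] at h₂
  have h₃ : {x ∈ p.roots.toFinset | x ≠ 0} ⊆ {x ∈ p.roots.toFinset | 0 < x} ∪
      {x ∈ (p.comp (-X)).roots.toFinset | 0 < x}.image (-·) := by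
    intro x hx
    simp only [Finset.mem_filter, Multiset.mem_toFinset, mem_roots hp, IsRoot.def] at hx
    rcases hx.2.lt_or_gt with h | h
    · refine Finset.mem_union_right _ (Finset.mem_image.2 ⟨-x, ?_, neg_neg x⟩)
      simp [hx.1, h, hp]
    · exact Finset.mem_union_left _ (by simp [hx.1, h, hp])
  have h₄ := (Finset.card_le_card h₃).trans (Finset.card_union_le _ _)
  have h₅ := Finset.card_image_le (s := {x ∈ (p.comp (-X)).roots.toFinset | 0 < x}) (f := (-·))
  omega


open Polynomial

/-- A nonzero polynomial of the form `g * ∏_j f_j^{α_j}`, with `g` an `h`-sparse polynomial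
and each `f_j` a nonzero `t`-sparse polynomial, has at most `2h + 2m(t-1) - 1` distinct
real roots. -/
theorem roots_of_single_product (m t h : ℕ) (hm : 1 ≤ m) (ht : 1 ≤ t) (hh : 1 ≤ h)
    (g : ℝ[X]) (hg : g.support.card ≤ h)
    (f : Fin m → ℝ[X]) (hf : ∀ j, f j ≠ 0 ∧ (f j).support.card ≤ t)
    (α : Fin m → ℕ)
    (hP : g * ∏ j, f j ^ α j ≠ 0) :
    {x : ℝ | (g * ∏ j, f j ^ α j).eval x = 0}.ncard ≤ 2 * h + 2 * m * (t - 1) - 1 := by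
  have hg₀ : g ≠ 0 := left_ne_zero_of_mul hP
  have hsub : {x : ℝ | (g * ∏ j, f j ^ α j).eval x = 0} ⊆
      (insert 0 ({x ∈ g.roots.toFinset | x ≠ 0} ∪
        Finset.univ.biUnion fun j ↦ {x ∈ (f j).roots.toFinset | x ≠ 0}) : Finset ℝ) := by
    intro x hx
    simp only [Set.mem_ofPred_eq, eval_mul, eval_prod, eval_pow, mul_eq_zero,
      Finset.prod_eq_zero_iff] at hx
    simp only [SetLike.mem_coe, Finset.mem_insert, Finset.mem_union, Finset.mem_biUnion,
      Finset.mem_filter, Multiset.mem_toFinset, mem_roots hg₀, IsRoot.def]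
    by_cases hx₀ : x = 0
    · exact Or.inl hx₀
    · rcases hx with hx | ⟨j, hj, hx⟩
      · exact Or.inr (Or.inl ⟨hx, hx₀⟩)
      · exact Or.inr (Or.inr ⟨j, hj, (mem_roots (hf j).1).2 (eq_zero_of_pow_eq_zero hx), hx₀⟩)
  have h₁ := Set.ncard_le_ncard hsub (Finset.finite_toSet _)
  rw [Set.ncard_coe_finset] at h₁
  have h₂ := Finset.card_insert_le (0 : ℝ) ({x ∈ g.roots.toFinset | x ≠ 0} ∪
    Finset.univ.biUnion fun j ↦ {x ∈ (f j).roots.toFinset | x ≠ 0})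
  have h₃ := Finset.card_union_le {x ∈ g.roots.toFinset | x ≠ 0}
    (Finset.univ.biUnion fun j ↦ {x ∈ (f j).roots.toFinset | x ≠ 0})
  have h₄ : (Finset.univ.biUnion fun j ↦ {x ∈ (f j).roots.toFinset | x ≠ 0}).card
      ≤ m * (2 * (t - 1)) := by
    simpa using Finset.card_biUnion_le_card_mul Finset.univ
      (fun j ↦ {x ∈ (f j).roots.toFinset | x ≠ 0}) (2 * (t - 1)) fun j _ ↦
        (card_filter_ne_zero_roots_le (hf j).1).trans (by have := (hf j).2; omega)
  have h₅ := card_filter_ne_zero_roots_le hg₀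
  have h₆ : m * (2 * (t - 1)) = 2 * m * (t - 1) := by ring
  omega
end
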